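/- arXiv:2007.12448 — 2 statements merged into one kernel-verified Lean document; each statement's English description precedes it below -/
import Mathlib

section
/- Let q ∈ (0,1). If sup T = b_k < ∞, then G_{μ_q(x)}(x, b_k) → 1−q as x → ∞. If inf T = a_1 > −∞, then G_{μ_q(x)}(x, a_1) → 1−q as x → −∞. -/
open MeasureTheory ProbabilityTheory Set Filter Topology

noncomputable def stdphi (x : ℝ) : ℝ := Real.exp (-(x ^ 2) / 2) / Real.sqrt (2 * Real.pi)

noncomputable def stdPhi (x : ℝ) : ℝ := ∫ t in Iic x, stdphi t

noncomputable def stdPhiInv : ℝ → ℝ := Function.invFun stdPhi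

noncomputable def stdPhiE (c : EReal) (x s : ℝ) : ℝ :=
  if c = ⊤ then 1 else if c = ⊥ then 0 else stdPhi ((c.toReal - x) / s)

def truncOrdered {k : ℕ} (a b : Fin k → EReal) : Prop :=
  (∀ i, a i < b i) ∧ ∀ i j : Fin k, i < j → b i < a j

def truncSet {k : ℕ} (a b : Fin k → EReal) : Set ℝ :=
  {x : ℝ | ∃ i, a i < (x : EReal) ∧ (x : EReal) < b i}

noncomputable def truncSum {k : ℕ} (a b : Fin k → EReal) (s x : ℝ) : ℝ :=
  ∑ i, (stdPhiE (b i) x s - stdPhiE (a i) x s)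

noncomputable def condPDF {k : ℕ} (a b : Fin k → EReal) (σ τ μ x : ℝ) : ℝ :=
  (1 / σ) * stdphi ((x - μ) / σ) * truncSum a b τ x
    / truncSum a b (Real.sqrt (σ ^ 2 + τ ^ 2)) μ

noncomputable def Fmu {k : ℕ} (a b : Fin k → EReal) (σ τ μ x : ℝ) : ℝ :=
  ∫ u in Iic x, condPDF a b σ τ μ u

/-- `G_μ(x,v) = Φ((x - (ρ²μ + (1-ρ²)v))/(σρ))` with `ρ² = τ²/(σ²+τ²)`. -/
noncomputable def Gfun (σ τ μ x v : ℝ) : ℝ :=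
  stdPhi ((x - (τ ^ 2 / (σ ^ 2 + τ ^ 2) * μ + (1 - τ ^ 2 / (σ ^ 2 + τ ^ 2)) * v)) /
    (σ * Real.sqrt (τ ^ 2 / (σ ^ 2 + τ ^ 2))))

/-- `G_μ(x,v)` for an extended-real `v`, with the natural conventions at `±∞`. -/
noncomputable def GfunE (σ τ μ x : ℝ) (c : EReal) : ℝ :=
  if c = ⊤ then 0 else if c = ⊥ then 1 else Gfun σ τ μ x c.toReal

/-- `h(v)` from Lemma `le_dmu_formula`. -/
noncomputable def hfun {k : ℕ} (a b : Fin k → EReal) (σ τ μ v : ℝ) : ℝ :=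
  (1 / Real.sqrt (σ ^ 2 + τ ^ 2)) * stdphi ((v - μ) / Real.sqrt (σ ^ 2 + τ ^ 2)) /
    truncSum a b (Real.sqrt (σ ^ 2 + τ ^ 2)) μ

/-- `h(v)` for an extended-real `v`, with the convention `φ(±∞) = 0`. -/
noncomputable def hfunE {k : ℕ} (a b : Fin k → EReal) (σ τ μ : ℝ) (c : EReal) : ℝ :=
  if c = ⊤ then 0 else if c = ⊥ then 0 else hfun a b σ τ μ c.toReal

/-- `l(x,v)` from Lemma `le_dens_dx`. -/
noncomputable def lfun {k : ℕ} (a b : Fin k → EReal) (τ x v : ℝ) : ℝ :=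
  (1 / τ) * stdphi ((v - x) / τ) / truncSum a b τ x

/-- `l(x,v)` for an extended-real `v`, with the convention `φ(±∞) = 0`. -/
noncomputable def lfunE {k : ℕ} (a b : Fin k → EReal) (τ x : ℝ) (c : EReal) : ℝ :=
  if c = ⊤ then 0 else if c = ⊥ then 0 else lfun a b τ x c.toReal

/-- The function `B_μ(x)` from the proof of Proposition 1. -/
noncomputable def Bfun {k : ℕ} (a b : Fin k → EReal) (σ τ μ x : ℝ) : ℝ :=
  Real.sqrt (τ ^ 2 / (σ ^ 2 + τ ^ 2)) / σ * stdphi (stdPhiInv (Fmu a b σ τ μ x))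
    - condPDF a b σ τ μ x
    + ∑ i, (hfunE a b σ τ μ (b i) * (Fmu a b σ τ μ x - GfunE σ τ μ x (b i))
        - hfunE a b σ τ μ (a i) * (Fmu a b σ τ μ x - GfunE σ τ μ x (a i)))

/-- The density of the normal distribution with mean `m` and standard deviation `s`. -/
noncomputable def normalDensity (s m v : ℝ) : ℝ := 1 / s * stdphi ((v - m) / s)

lemma stdphi_eq_gaussianPDFReal : stdphi = gaussianPDFReal 0 1 := by
  ext x
  simp [stdphi, gaussianPDFReal]
  ring

lemma stdphi_pos (x : ℝ) : 0 < stdphi x := by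
  unfold stdphi
  positivity

lemma stdphi_neg (x : ℝ) : stdphi (-x) = stdphi x := by
  simp [stdphi]

lemma stdphi_le_one (x : ℝ) : stdphi x ≤ 1 := by
  unfold stdphi
  have h1 : Real.exp (-(x ^ 2) / 2) ≤ 1 := Real.exp_le_one_iff.2 (by nlinarith [sq_nonneg x])
  have h2 : 1 ≤ Real.sqrt (2 * Real.pi) :=
    Real.one_le_sqrt.2 (by nlinarith [Real.pi_gt_three])
  exact div_le_one_of_le₀ (h1.trans h2) (by positivity)

lemma integrable_stdphi : Integrable stdphi :=
  stdphi_eq_gaussianPDFReal ▸ integrable_gaussianPDFReal 0 1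

lemma integral_stdphi : ∫ x, stdphi x = 1 := by
  rw [stdphi_eq_gaussianPDFReal]
  exact integral_gaussianPDFReal_eq_one 0 one_ne_zero

lemma stdPhi_eq_cdf : stdPhi = cdf (gaussianReal 0 1) := by
  ext x
  rw [cdf_eq_real, measureReal_def, gaussianReal_apply_eq_integral 0 one_ne_zero,
    ENNReal.toReal_ofReal (integral_nonneg (gaussianPDFReal_nonneg 0 1)), stdPhi,
    stdphi_eq_gaussianPDFReal]

lemma monotone_stdPhi : Monotone stdPhi := by
  rw [stdPhi_eq_cdf]
  exact monotone_cdf _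

lemma stdPhi_nonneg (x : ℝ) : 0 ≤ stdPhi x :=
  integral_nonneg fun t => (stdphi_pos t).le

lemma stdPhi_le_one (x : ℝ) : stdPhi x ≤ 1 := by
  rw [stdPhi_eq_cdf]
  exact cdf_le_one _ x

lemma tendsto_stdPhi_atTop : Tendsto stdPhi atTop (𝓝 1) := by
  rw [stdPhi_eq_cdf]
  exact tendsto_cdf_atTop _

lemma stdPhi_neg (x : ℝ) : stdPhi (-x) = 1 - stdPhi x := by
  have h := intervalIntegral.integral_Iic_add_Ioi (b := x) integrable_stdphi.integrableOn
    integrable_stdphi.integrableOn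
  have h2 : ∫ t in Iic (-x), stdphi t = ∫ t in Ioi x, stdphi t := by
    simpa [stdphi_neg] using integral_comp_neg_Iic (-x) stdphi
  rw [integral_stdphi] at h
  rw [stdPhi, stdPhi, h2]
  linarith

lemma stdPhi_add_le (x : ℝ) {t : ℝ} (ht : 0 ≤ t) : stdPhi (x + t) ≤ stdPhi x + t := by
  have h := intervalIntegral.integral_Iic_sub_Iic (a := x) (b := x + t)
    integrable_stdphi.integrableOn integrable_stdphi.integrableOn
  have h2 : ∫ u in x..(x + t), stdphi u ≤ ∫ _u in x..(x + t), (1 : ℝ) :=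
    intervalIntegral.integral_mono_on (by linarith) integrable_stdphi.intervalIntegrable
      intervalIntegrable_const fun u _ => stdphi_le_one u
  rw [intervalIntegral.integral_const] at h2
  simp only [add_sub_cancel_left, smul_eq_mul, mul_one] at h2
  unfold stdPhi
  linarith

lemma normalDensity_pos {s : ℝ} (hs : 0 < s) (m v : ℝ) : 0 < normalDensity s m v :=
  mul_pos (by positivity) (stdphi_pos _)

lemma normalDensity_eq_comp_sub (s m : ℝ) :
    normalDensity s m = fun v => normalDensity s 0 (v - m) := by
  ext v
  simp [normalDensity]

lemma normalDensity_neg (s m v : ℝ) : normalDensity s (-m) (-v) = normalDensity s m v := by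
  rw [normalDensity, normalDensity, ← stdphi_neg]
  congr 2
  ring

lemma integrable_normalDensity {s : ℝ} (hs : 0 < s) (m : ℝ) :
    Integrable (normalDensity s m) :=
  ((integrable_stdphi.comp_div hs.ne').comp_sub_right m).const_mul (1 / s)

lemma integral_comp_sub_div {s : ℝ} (hs : 0 < s) (m : ℝ) (f : ℝ → ℝ) :
    ∫ v, 1 / s * f ((v - m) / s) = ∫ v, f v := by
  rw [integral_const_mul, integral_sub_right_eq_self (fun v => f (v / s)) m,
    Measure.integral_comp_div, abs_of_pos hs, smul_eq_mul]
  field_simp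

lemma integral_normalDensity {s : ℝ} (hs : 0 < s) (m : ℝ) :
    ∫ v, normalDensity s m v = 1 :=
  (integral_comp_sub_div hs m stdphi).trans integral_stdphi

lemma setIntegral_Iic_normalDensity {s : ℝ} (hs : 0 < s) (m x : ℝ) :
    ∫ v in Iic x, normalDensity s m v = stdPhi ((x - m) / s) := by
  rw [stdPhi, ← integral_indicator measurableSet_Iic, ← integral_indicator measurableSet_Iic,
    ← integral_comp_sub_div hs m ((Iic ((x - m) / s)).indicator stdphi)]
  congr 1
  ext v
  have : (v - m) / s ≤ (x - m) / s ↔ v ≤ x := by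
    rw [div_le_div_iff_of_pos_right hs, sub_le_sub_iff_right]
  simp [indicator, normalDensity, this]

lemma normalDensity_eq_mul_exp {s : ℝ} (hs : 0 < s) (m v : ℝ) :
    normalDensity s m v =
      normalDensity s 0 v * Real.exp (m * v / s ^ 2 - m ^ 2 / (2 * s ^ 2)) := by
  unfold normalDensity stdphi
  rw [mul_assoc, div_mul_eq_mul_div (Real.exp _), ← Real.exp_add]
  congr 3
  field_simp
  ring

lemma normalDensity_mul_normalDensity {σ τ : ℝ} (hσ : 0 < σ) (hτ : 0 < τ) (μ u v : ℝ) :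
    normalDensity σ μ u * normalDensity τ u v =
      normalDensity (σ * Real.sqrt (τ ^ 2 / (σ ^ 2 + τ ^ 2)))
        (τ ^ 2 / (σ ^ 2 + τ ^ 2) * μ + (1 - τ ^ 2 / (σ ^ 2 + τ ^ 2)) * v) u *
      normalDensity (Real.sqrt (σ ^ 2 + τ ^ 2)) μ v := by
  rw [Real.sqrt_div (sq_nonneg τ), Real.sqrt_sq hτ.le]
  obtain ⟨s, hs, hs2⟩ : ∃ s, 0 < s ∧ s ^ 2 = σ ^ 2 + τ ^ 2 :=
    ⟨Real.sqrt (σ ^ 2 + τ ^ 2), by positivity, Real.sq_sqrt (by positivity)⟩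
  rw [← hs2, Real.sqrt_sq hs.le]
  simp only [normalDensity, stdphi]
  have h (c d e f w : ℝ) :
      c * (Real.exp d / w) * (e * (Real.exp f / w)) = c * e * Real.exp (d + f) / w ^ 2 := by
    rw [Real.exp_add]
    ring
  rw [h, h]
  have hc : 1 / σ * (1 / τ) = 1 / (σ * (τ / s)) * (1 / s) := by field_simp
  have he : -((u - μ) / σ) ^ 2 / 2 + -((v - u) / τ) ^ 2 / 2 =
      -((u - (τ ^ 2 / s ^ 2 * μ + (1 - τ ^ 2 / s ^ 2) * v)) / (σ * (τ / s))) ^ 2 / 2 +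
        -((v - μ) / s) ^ 2 / 2 := by
    simp only [div_pow, mul_pow, hs2]
    field_simp
    ring
  rw [hc, he]

lemma setIntegral_normalDensity_pos {s : ℝ} (hs : 0 < s) (m : ℝ) {T : Set ℝ} {d B : ℝ}
    (hdB : d < B) (hT : Ioo d B ⊆ T) : 0 < ∫ v in T, normalDensity s m v := by
  rw [setIntegral_pos_iff_support_of_nonneg_ae
    (Eventually.of_forall fun v => (normalDensity_pos hs m v).le)
    (integrable_normalDensity hs m).integrableOn]
  have : Function.support (normalDensity s m) = univ :=
    eq_univ_of_forall fun v => (normalDensity_pos hs m v).ne'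
  rw [this, univ_inter]
  exact lt_of_lt_of_le (by simpa using hdB) (measure_mono hT)

lemma integrable_stdPhi_mul_normalDensity {s : ℝ} (hs : 0 < s) (m : ℝ) {f : ℝ → ℝ}
    (hf : Measurable f) : Integrable fun v => stdPhi (f v) * normalDensity s m v := by
  refine (integrable_normalDensity hs m).bdd_mul (c := 1)
    (monotone_stdPhi.measurable.comp hf).aestronglyMeasurable (Eventually.of_forall fun v => ?_)
  rw [Real.norm_of_nonneg (stdPhi_nonneg _)]
  exact stdPhi_le_one _

lemma eventually_setIntegral_Iic_normalDensity_le {s : ℝ} (hs : 0 < s) {T : Set ℝ} {c d B : ℝ}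
    (hcd : c < d) (hdB : d < B) (hT : Ioo d B ⊆ T) {ε : ℝ} (hε : 0 < ε) :
    ∀ᶠ m in atTop, ∫ v in Iic c, normalDensity s m v ≤ ε * ∫ v in T, normalDensity s m v := by
  set P := ∫ v in Ioo d B, normalDensity s 0 v
  have hP0 : 0 < P := setIntegral_normalDensity_pos hs 0 hdB subset_rfl
  have hlim : Tendsto (fun m : ℝ => Real.exp (-(m * ((d - c) / s ^ 2)))) atTop (𝓝 0) :=
    Real.tendsto_exp_neg_atTop_nhds_zero.comp
      (tendsto_id.atTop_mul_const (div_pos (sub_pos.2 hcd) (by positivity)))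
  filter_upwards [hlim.eventually (gt_mem_nhds (mul_pos hε hP0)), eventually_ge_atTop 0]
    with m hm hm0
  set E : ℝ → ℝ := fun v => Real.exp (m * v / s ^ 2 - m ^ 2 / (2 * s ^ 2)) with hE
  have hEmono : Monotone E := fun v w hvw => by
    simp only [hE]
    gcongr
  have hint (m : ℝ) (S : Set ℝ) : IntegrableOn (normalDensity s m) S :=
    (integrable_normalDensity hs m).integrableOn
  have hupper : ∫ v in Iic c, normalDensity s m v ≤ E c := by
    calc ∫ v in Iic c, normalDensity s m v ≤ ∫ v in Iic c, normalDensity s 0 v * E c := by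
          refine setIntegral_mono_on (hint m _) ((hint 0 _).mul_const _) measurableSet_Iic ?_
          intro v hv
          rw [normalDensity_eq_mul_exp hs]
          exact mul_le_mul_of_nonneg_left (hEmono hv) (normalDensity_pos hs 0 v).le
      _ = (∫ v in Iic c, normalDensity s 0 v) * E c := integral_mul_const _ _
      _ ≤ 1 * E c := by
          gcongr
          rw [setIntegral_Iic_normalDensity hs]
          exact stdPhi_le_one _
      _ = E c := one_mul _
  have hlower : P * E d ≤ ∫ v in T, normalDensity s m v := by
    calc P * E d = ∫ v in Ioo d B, normalDensity s 0 v * E d := (integral_mul_const _ _).symm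
      _ ≤ ∫ v in Ioo d B, normalDensity s m v := by
          refine setIntegral_mono_on ((hint 0 _).mul_const _) (hint m _) measurableSet_Ioo ?_
          intro v hv
          rw [normalDensity_eq_mul_exp hs m]
          exact mul_le_mul_of_nonneg_left (hEmono hv.1.le) (normalDensity_pos hs 0 v).le
      _ ≤ ∫ v in T, normalDensity s m v :=
          setIntegral_mono_set (hint m _)
            (Eventually.of_forall fun v => (normalDensity_pos hs m v).le) hT.eventuallyLE
  have hEcd : E c = Real.exp (-(m * ((d - c) / s ^ 2))) * E d := by
    simp only [hE]
    rw [← Real.exp_add]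
    congr 1
    ring
  calc ∫ v in Iic c, normalDensity s m v ≤ E c := hupper
    _ = Real.exp (-(m * ((d - c) / s ^ 2))) * E d := hEcd
    _ ≤ ε * P * E d := by gcongr
    _ = ε * (P * E d) := mul_assoc _ _ _
    _ ≤ ε * ∫ v in T, normalDensity s m v := by gcongr

/-- If the `normalDensity s (m x)`-average over `T` of `v ↦ Φ((x - (r m(x) + (1 - r) v)) / A)`
equals `p` for every `x`, then the value of this function at `v = sup T` tends to `p`. -/
lemma tendsto_stdPhi_of_setIntegral_eq {s A r p B d : ℝ} (hs : 0 < s) (hA : 0 < A)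
    (hr0 : 0 < r) (hr1 : r < 1) (hp : p < 1) {T : Set ℝ} (hTm : MeasurableSet T)
    (hTB : ∀ v ∈ T, v ≤ B) (hdB : d < B) (hT : Ioo d B ⊆ T) {m : ℝ → ℝ}
    (h : ∀ x, ∫ v in T, stdPhi ((x - (r * m x + (1 - r) * v)) / A) * normalDensity s (m x) v =
      p * ∫ v in T, normalDensity s (m x) v) :
    Tendsto (fun x => stdPhi ((x - (r * m x + (1 - r) * B)) / A)) atTop (𝓝 p) := by
  have hint (m : ℝ) (S : Set ℝ) : IntegrableOn (normalDensity s m) S :=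
    (integrable_normalDensity hs m).integrableOn
  have hpos (m : ℝ) : 0 < ∫ v in T, normalDensity s m v :=
    setIntegral_normalDensity_pos hs m hdB hT
  have hintG (x : ℝ) : IntegrableOn (fun v =>
      stdPhi ((x - (r * m x + (1 - r) * v)) / A) * normalDensity s (m x) v) T :=
    (integrable_stdPhi_mul_normalDensity hs _ (by fun_prop)).integrableOn
  have hle (x : ℝ) : stdPhi ((x - (r * m x + (1 - r) * B)) / A) ≤ p := by
    refine le_of_mul_le_mul_right ?_ (hpos (m x))
    rw [← h x, ← integral_const_mul]
    refine setIntegral_mono_on ((hint _ _).const_mul _) (hintG x) hTm fun v hv => ?_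
    refine mul_le_mul_of_nonneg_right (monotone_stdPhi ?_) (normalDensity_pos hs _ v).le
    have := hTB v hv
    have := sub_pos.2 hr1
    gcongr
  have hm : Tendsto m atTop atTop := by
    obtain ⟨y, hy⟩ := (tendsto_stdPhi_atTop.eventually (lt_mem_nhds hp)).exists
    have hlin : Tendsto (fun x => (x - ((1 - r) * B + y * A)) / r) atTop atTop :=
      (tendsto_atTop_add_const_right atTop _ tendsto_id).atTop_div_const hr0
    refine tendsto_atTop_mono (fun x => ?_) hlin
    have h1 : (x - (r * m x + (1 - r) * B)) / A < y :=
      monotone_stdPhi.reflect_lt ((hle x).trans_lt hy)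
    rw [div_lt_iff₀ hA] at h1
    rw [div_le_iff₀ hr0]
    linarith
  refine tendsto_order.2 ⟨fun p' hp' => ?_, fun p' hp' =>
    Eventually.of_forall fun x => (hle x).trans_lt hp'⟩
  set ε := (p - p') / 3 with hε
  have hε0 : 0 < ε := by
    rw [hε]
    linarith
  have hr : 0 < 1 - r := sub_pos.2 hr1
  set δ := ε * A / (1 - r) with hδ
  have hδ0 : 0 < δ := by positivity
  obtain ⟨e, he, heB⟩ := exists_between (max_lt hdB (sub_lt_self B hδ0))
  obtain ⟨hde, hce⟩ := max_lt_iff.1 he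
  filter_upwards [hm.eventually (eventually_setIntegral_Iic_normalDensity_le hs hce heB
    ((Ioo_subset_Ioo_left hde.le).trans hT) hε0)] with x hx
  set g := stdPhi ((x - (r * m x + (1 - r) * B)) / A) with hg
  have hkey : p * ∫ v in T, normalDensity s (m x) v ≤
      (g + ε) * (∫ v in T, normalDensity s (m x) v) +
        ∫ v in T, (Iic (B - δ)).indicator (normalDensity s (m x)) v := by
    have hint2 : IntegrableOn ((Iic (B - δ)).indicator (normalDensity s (m x))) T :=
      ((integrable_normalDensity hs (m x)).indicator measurableSet_Iic).integrableOn
    rw [← h x, ← integral_const_mul, ← integral_add ((hint _ _).const_mul _) hint2]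
    refine setIntegral_mono_on (hintG x) (((hint _ _).const_mul _).add hint2) hTm fun v _ => ?_
    have hn := normalDensity_pos hs (m x) v
    by_cases hv : v ≤ B - δ
    · rw [indicator_of_mem (show v ∈ Iic (B - δ) from hv)]
      have h1 := mul_le_mul_of_nonneg_right
        (stdPhi_le_one ((x - (r * m x + (1 - r) * v)) / A)) hn.le
      have h2 : 0 ≤ (g + ε) * normalDensity s (m x) v :=
        mul_nonneg (add_nonneg (stdPhi_nonneg _) hε0.le) hn.le
      linarith
    · rw [indicator_of_notMem (show v ∉ Iic (B - δ) from hv), add_zero]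
      refine mul_le_mul_of_nonneg_right (le_trans (monotone_stdPhi ?_)
        (stdPhi_add_le ((x - (r * m x + (1 - r) * B)) / A) hε0.le)) hn.le
      have hεA : ε = (1 - r) * δ / A := by
        rw [hδ]
        field_simp
      rw [hεA, ← add_div]
      have := mul_le_mul_of_nonneg_left (not_le.1 hv).le hr.le
      gcongr
      linarith
  have htail : ∫ v in T, (Iic (B - δ)).indicator (normalDensity s (m x)) v ≤
      ∫ v in Iic (B - δ), normalDensity s (m x) v := by
    rw [← integral_indicator measurableSet_Iic]
    exact setIntegral_le_integral
      ((integrable_normalDensity hs (m x)).indicator measurableSet_Iic)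
      (Eventually.of_forall (indicator_nonneg fun v _ => (normalDensity_pos hs (m x) v).le))
  have : p ≤ g + ε + ε := by
    refine le_of_mul_le_mul_right ?_ (hpos (m x))
    linarith
  linarith

/-- The counterpart of `tendsto_stdPhi_of_setIntegral_eq` at `inf T`, obtained by reflection. -/
lemma tendsto_stdPhi_of_setIntegral_eq_atBot {s A r p B d : ℝ} (hs : 0 < s) (hA : 0 < A)
    (hr0 : 0 < r) (hr1 : r < 1) (hp : 0 < p) {T : Set ℝ} (hTm : MeasurableSet T)
    (hTB : ∀ v ∈ T, B ≤ v) (hdB : B < d) (hT : Ioo B d ⊆ T) {m : ℝ → ℝ}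
    (h : ∀ x, ∫ v in T, stdPhi ((x - (r * m x + (1 - r) * v)) / A) * normalDensity s (m x) v =
      p * ∫ v in T, normalDensity s (m x) v) :
    Tendsto (fun x => stdPhi ((x - (r * m x + (1 - r) * B)) / A)) atBot (𝓝 p) := by
  have hreflect (x μ v : ℝ) : stdPhi ((x - (r * μ + (1 - r) * v)) / A) =
      1 - stdPhi ((-x - (r * -μ + (1 - r) * -v)) / A) := by
    rw [← stdPhi_neg]
    congr 1
    ring
  have hneg (f : ℝ → ℝ) : ∫ v in Neg.neg ⁻¹' T, f (-v) = ∫ v in T, f v :=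
    (Measure.measurePreserving_neg volume).setIntegral_preimage_emb
      (Homeomorph.neg ℝ).measurableEmbedding f T
  have hint (m : ℝ) : IntegrableOn (normalDensity s m) T :=
    (integrable_normalDensity hs m).integrableOn
  have hlim := tendsto_stdPhi_of_setIntegral_eq (T := Neg.neg ⁻¹' T) (B := -B) (d := -d)
    (p := 1 - p) (m := fun x => -m (-x)) hs hA hr0 hr1 (by linarith) (hTm.preimage measurable_neg)
    (fun v hv => by linarith [hTB _ hv]) (neg_lt_neg hdB)
    (fun v hv => hT ⟨by linarith [hv.2], by linarith [hv.1]⟩) fun x => by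
      have hx := h (-x)
      have hE : ∫ v in T, normalDensity s (m (-x)) v =
          ∫ v in Neg.neg ⁻¹' T, normalDensity s (-m (-x)) v := by
        rw [← hneg]
        exact integral_congr_ae (Eventually.of_forall fun v => by
          simpa using normalDensity_neg s (-m (-x)) v)
      have hG : ∫ v in T, (normalDensity s (m (-x)) v -
          stdPhi ((-x - (r * m (-x) + (1 - r) * v)) / A) * normalDensity s (m (-x)) v) =
          ∫ v in Neg.neg ⁻¹' T, stdPhi ((x - (r * -m (-x) + (1 - r) * v)) / A) *
            normalDensity s (-m (-x)) v := by
        rw [← hneg]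
        refine integral_congr_ae (Eventually.of_forall fun v => ?_)
        have hn := normalDensity_neg s (-m (-x)) v
        rw [neg_neg] at hn
        simp only [hreflect x, neg_neg, hn]
        ring
      rw [← hG, ← hE, integral_sub (hint _)
        (integrable_stdPhi_mul_normalDensity hs _ (by fun_prop)).integrableOn, hx]
      ring
  have := (hlim.comp tendsto_neg_atBot_atTop).const_sub 1
  simp only [Function.comp_def, neg_neg, sub_sub_cancel] at this
  exact this.congr fun x => (hreflect _ _ _).symm

/-- The union of the intervals `(a i, b i]`, which agrees with the truncation set `⋃ (a i, b i)`
up to finitely many points. -/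
def truncIocSet {k : ℕ} (a b : Fin k → EReal) : Set ℝ :=
  ⋃ i, {v : ℝ | a i < (v : EReal) ∧ (v : EReal) ≤ b i}

lemma measurableSet_ereal_Ioc (a b : EReal) :
    MeasurableSet {v : ℝ | a < (v : EReal) ∧ (v : EReal) ≤ b} :=
  measurable_coe_real_ereal measurableSet_Ioc

lemma measurableSet_truncIocSet {k : ℕ} (a b : Fin k → EReal) :
    MeasurableSet (truncIocSet a b) :=
  MeasurableSet.iUnion fun i => measurableSet_ereal_Ioc (a i) (b i)

lemma stdPhiE_eq_setIntegral {s : ℝ} (hs : 0 < s) (c : EReal) (x : ℝ) :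
    stdPhiE c x s = ∫ v in {v : ℝ | (v : EReal) ≤ c}, normalDensity s x v := by
  induction c with
  | bot => simp [stdPhiE]
  | top => simp [stdPhiE, integral_normalDensity hs]
  | coe c =>
    simp only [stdPhiE, EReal.coe_ne_top, EReal.coe_ne_bot, if_false, EReal.toReal_coe,
      EReal.coe_le_coe_iff]
    exact (setIntegral_Iic_normalDensity hs x c).symm

lemma stdPhiE_sub_stdPhiE {s : ℝ} (hs : 0 < s) {a b : EReal} (hab : a ≤ b) (x : ℝ) :
    stdPhiE b x s - stdPhiE a x s =
      ∫ v in {v : ℝ | a < (v : EReal) ∧ (v : EReal) ≤ b}, normalDensity s x v := by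
  have hset : {v : ℝ | a < (v : EReal) ∧ (v : EReal) ≤ b} =
      {v : ℝ | (v : EReal) ≤ b} \ {v : ℝ | (v : EReal) ≤ a} := by
    ext v
    simp [and_comm]
  rw [hset, stdPhiE_eq_setIntegral hs, stdPhiE_eq_setIntegral hs]
  exact (setIntegral_sdiff (measurable_coe_real_ereal measurableSet_Iic)
    (integrable_normalDensity hs x).integrableOn
    (fun v (hv : (v : EReal) ≤ a) => hv.trans hab)).symm

lemma truncSum_eq_setIntegral {k : ℕ} {a b : Fin k → EReal} (hab : truncOrdered a b) {s : ℝ}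
    (hs : 0 < s) (x : ℝ) :
    truncSum a b s x = ∫ v in truncIocSet a b, normalDensity s x v := by
  have hdisj : Pairwise (Function.onFun Disjoint
      fun i => {v : ℝ | a i < (v : EReal) ∧ (v : EReal) ≤ b i}) := by
    refine (pairwise_disjoint_on _).2 fun i j hij => disjoint_left.2 fun v hi hj => ?_
    exact absurd ((hab.2 i j hij).trans hj.1) (not_lt.2 hi.2)
  rw [truncIocSet, integral_iUnion_fintype (fun i => measurableSet_ereal_Ioc (a i) (b i)) hdisj
    fun i => (integrable_normalDensity hs x).integrableOn]
  exact Finset.sum_congr rfl fun i _ => stdPhiE_sub_stdPhiE hs (hab.1 i).le x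

lemma integrable_normalDensity_mul_normalDensity {σ τ : ℝ} (hσ : 0 < σ) (hτ : 0 < τ) (μ : ℝ) :
    Integrable (fun p : ℝ × ℝ => normalDensity σ μ p.1 * normalDensity τ p.1 p.2)
      (volume.prod volume) := by
  have h := ((integrable_normalDensity hσ μ).convolution_integrand (.mul ℝ ℝ)
    (integrable_normalDensity hτ 0)).swap
  refine h.congr (Eventually.of_forall fun p => ?_)
  simp [normalDensity_eq_comp_sub τ p.1]

lemma Fmu_mul_eq_setIntegral {k : ℕ} {a b : Fin k → EReal} (hab : truncOrdered a b)
    {σ τ : ℝ} (hσ : 0 < σ) (hτ : 0 < τ) (μ x : ℝ)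
    (hT : truncSum a b (Real.sqrt (σ ^ 2 + τ ^ 2)) μ ≠ 0) :
    ∫ v in truncIocSet a b, Gfun σ τ μ x v * normalDensity (Real.sqrt (σ ^ 2 + τ ^ 2)) μ v =
      Fmu a b σ τ μ x *
        ∫ v in truncIocSet a b, normalDensity (Real.sqrt (σ ^ 2 + τ ^ 2)) μ v := by
  have hs : 0 < Real.sqrt (σ ^ 2 + τ ^ 2) := by positivity
  have hA : 0 < σ * Real.sqrt (τ ^ 2 / (σ ^ 2 + τ ^ 2)) := by positivity
  rw [← truncSum_eq_setIntegral hab hs, Fmu]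
  simp only [condPDF]
  rw [integral_div, div_mul_cancel₀ _ hT]
  calc ∫ v in truncIocSet a b, Gfun σ τ μ x v * normalDensity (Real.sqrt (σ ^ 2 + τ ^ 2)) μ v
      = ∫ v in truncIocSet a b, ∫ u in Iic x, normalDensity σ μ u * normalDensity τ u v := by
        congr 1 with v
        simp only [normalDensity_mul_normalDensity hσ hτ]
        rw [integral_mul_const, setIntegral_Iic_normalDensity hA, Gfun]
    _ = ∫ u in Iic x, ∫ v in truncIocSet a b, normalDensity σ μ u * normalDensity τ u v := by
        refine (integral_integral_swap ?_).symm
        rw [Measure.prod_restrict]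
        exact (integrable_normalDensity_mul_normalDensity hσ hτ μ).integrableOn
    _ = ∫ u in Iic x, 1 / σ * stdphi ((u - μ) / σ) * truncSum a b τ u := by
        congr 1 with u
        rw [integral_const_mul, truncSum_eq_setIntegral hab hτ, normalDensity]

/-- Proposition 2: if `sup T = bₖ < ∞` then `G_{μ_q(x)}(x, bₖ) → 1 - q` as `x → ∞`; if
`inf T = a₁ > -∞` then `G_{μ_q(x)}(x, a₁) → 1 - q` as `x → -∞`. -/
theorem stmt8 {k : ℕ} (a b : Fin (k + 1) → EReal) (hab : truncOrdered a b)
    (σ τ : ℝ) (hσ : 0 < σ) (hτ : 0 < τ)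
    (q : ℝ) (hq : q ∈ Ioo (0 : ℝ) 1)
    (μq : ℝ → ℝ → ℝ)
    (hμq : ∀ p ∈ Ioo (0 : ℝ) 1, ∀ x : ℝ, Fmu a b σ τ (μq p x) x = 1 - p) :
    (b (Fin.last k) ≠ ⊤ →
      Tendsto (fun x => Gfun σ τ (μq q x) x ((b (Fin.last k)).toReal)) atTop (𝓝 (1 - q))) ∧
    (a 0 ≠ ⊥ →
      Tendsto (fun x => Gfun σ τ (μq q x) x ((a 0).toReal)) atBot (𝓝 (1 - q))) := by
  have hs : 0 < Real.sqrt (σ ^ 2 + τ ^ 2) := by positivity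
  have hA : 0 < σ * Real.sqrt (τ ^ 2 / (σ ^ 2 + τ ^ 2)) := by positivity
  have hr0 : 0 < τ ^ 2 / (σ ^ 2 + τ ^ 2) := by positivity
  have hr1 : τ ^ 2 / (σ ^ 2 + τ ^ 2) < 1 := by
    rw [div_lt_one (by positivity)]
    nlinarith
  have heq {d e : ℝ} (hde : d < e) (hsub : Ioo d e ⊆ truncIocSet a b) (x : ℝ) :
      ∫ v in truncIocSet a b,
        Gfun σ τ (μq q x) x v * normalDensity (Real.sqrt (σ ^ 2 + τ ^ 2)) (μq q x) v =
      (1 - q) *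
        ∫ v in truncIocSet a b, normalDensity (Real.sqrt (σ ^ 2 + τ ^ 2)) (μq q x) v := by
    rw [Fmu_mul_eq_setIntegral hab hσ hτ, hμq q hq x]
    rw [truncSum_eq_setIntegral hab hs]
    exact (setIntegral_normalDensity_pos hs _ hde hsub).ne'
  constructor
  · intro hb
    obtain ⟨d, had, hdb⟩ := EReal.lt_iff_exists_real_btwn.1 (hab.1 (Fin.last k))
    lift b (Fin.last k) to ℝ using ⟨hb, ne_bot_of_gt hdb⟩ with B hB
    have hsub : Ioo d B ⊆ truncIocSet a b := fun v hv => mem_iUnion.2 ⟨Fin.last k,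
      had.trans (EReal.coe_lt_coe_iff.2 hv.1), hB ▸ (EReal.coe_lt_coe_iff.2 hv.2).le⟩
    have hle : ∀ v ∈ truncIocSet a b, v ≤ B := by
      intro v hv
      obtain ⟨i, -, hi⟩ := mem_iUnion.1 hv
      rw [← EReal.coe_le_coe_iff, hB]
      rcases (Fin.le_last i).eq_or_lt with rfl | hlt
      · exact hi
      · exact hi.trans ((hab.2 _ _ hlt).trans (hab.1 _)).le
    have hdB := EReal.coe_lt_coe_iff.1 hdb
    exact tendsto_stdPhi_of_setIntegral_eq hs hA hr0 hr1 (by linarith [hq.1])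
      (measurableSet_truncIocSet a b) hle hdB hsub (heq hdB hsub)
  · intro ha
    obtain ⟨d, had, hdb⟩ := EReal.lt_iff_exists_real_btwn.1 (hab.1 0)
    lift a 0 to ℝ using ⟨ne_top_of_lt had, ha⟩ with B hB
    have hsub : Ioo B d ⊆ truncIocSet a b := fun v hv => mem_iUnion.2 ⟨0,
      hB ▸ EReal.coe_lt_coe_iff.2 hv.1, ((EReal.coe_lt_coe_iff.2 hv.2).trans hdb).le⟩
    have hle : ∀ v ∈ truncIocSet a b, B ≤ v := by
      intro v hv
      obtain ⟨i, hi, -⟩ := mem_iUnion.1 hv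
      rw [← EReal.coe_le_coe_iff, hB]
      rcases (Fin.zero_le i).eq_or_lt with rfl | hlt
      · exact hi.le
      · exact (((hab.1 _).trans (hab.2 _ _ hlt)).trans hi).le
    have hBd := EReal.coe_lt_coe_iff.1 had
    exact tendsto_stdPhi_of_setIntegral_eq_atBot hs hA hr0 hr1 (by linarith [hq.2])
      (measurableSet_truncIocSet a b) hle hBd hsub (heq hBd hsub)
end

section
/- For all x ∈ ℝ and all μ ∈ ℝ, the derivative of Φ⁻¹(F_μ(x)) with respect to μ equals [−f_μ(x) + Σ_{i=1}^k (h(b_i)·(F_μ(x) − G_μ(x,b_i)) − h(a_i)·(F_μ(x) − G_μ(x,a_i)))] / φ(Φ⁻¹(F_μ(x))). -/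
open MeasureTheory ProbabilityTheory Set Filter Topology

/-- The density of the normal distribution with mean `m` and standard deviation `s`. -/
noncomputable def normalPDF (s m v : ℝ) : ℝ := (1 / s) * stdphi ((v - m) / s)

/-- The function `φ((c - x)/s)` for an extended-real `c`, with `φ(±∞) = 0`. -/
noncomputable def stdphiE (c : EReal) (x s : ℝ) : ℝ :=
  if c = ⊤ then 0 else if c = ⊥ then 0 else stdphi ((c.toReal - x) / s)

lemma continuous_stdphi : Continuous stdphi := by
  unfold stdphi
  fun_prop

lemma hasDerivAt_stdphi (x : ℝ) : HasDerivAt stdphi (-x * stdphi x) x := by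
  have h : HasDerivAt (fun y : ℝ => -(y ^ 2) / 2) (-x) x :=
    ((hasDerivAt_pow 2 x).fun_neg.div_const 2).congr_deriv (by ring)
  exact (h.exp.div_const (Real.sqrt (2 * Real.pi))).congr_deriv (by rw [stdphi]; ring)

lemma normalPDF_pos {s : ℝ} (hs : 0 < s) (m v : ℝ) : 0 < normalPDF s m v :=
  mul_pos (by positivity) (stdphi_pos _)

lemma normalPDF_eq_gaussianPDFReal {s : ℝ} (hs : 0 < s) (m : ℝ) :
    normalPDF s m = gaussianPDFReal m (Real.toNNReal s ^ 2) := by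
  ext v
  have h1 : Real.sqrt (2 * Real.pi * s ^ 2) = Real.sqrt (2 * Real.pi) * s := by
    rw [Real.sqrt_mul (by positivity), Real.sqrt_sq hs.le]
  have h2 : -((v - m) / s) ^ 2 / 2 = -(v - m) ^ 2 / (2 * s ^ 2) := by
    field_simp
  simp only [normalPDF, stdphi, gaussianPDFReal, NNReal.coe_pow, Real.coe_toNNReal s hs.le, h1, h2]
  field_simp

lemma integrable_normalPDF {s : ℝ} (hs : 0 < s) (m : ℝ) : Integrable (normalPDF s m) := by
  rw [normalPDF_eq_gaussianPDFReal hs]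
  exact integrable_gaussianPDFReal _ _

lemma continuous_normalPDF (s m : ℝ) : Continuous (normalPDF s m) := by
  unfold normalPDF
  exact continuous_const.mul (continuous_stdphi.comp (by fun_prop))

lemma normalPDF_one_zero : normalPDF 1 0 = stdphi := by
  ext v
  simp [normalPDF]

lemma gaussianReal_real_Iic {s : ℝ} (hs : 0 < s) (m c : ℝ) :
    (gaussianReal m (Real.toNNReal s ^ 2)).real (Iic c) = ∫ v in Iic c, normalPDF s m v := by
  have hv : Real.toNNReal s ^ 2 ≠ 0 := by simpa using hs
  rw [measureReal_def, gaussianReal_apply_eq_integral _ hv, normalPDF_eq_gaussianPDFReal hs,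
    ENNReal.toReal_ofReal]
  exact integral_nonneg fun _ => gaussianPDFReal_nonneg _ _ _

lemma tendsto_stdPhi_atBot : Tendsto stdPhi atBot (𝓝 0) := by
  rw [stdPhi_eq_cdf]
  exact tendsto_cdf_atBot _

lemma hasDerivAt_stdPhi (x : ℝ) : HasDerivAt stdPhi (stdphi x) x := by
  have h : stdPhi = fun y => stdPhi 0 + ∫ t in (0 : ℝ)..y, stdphi t := by
    ext y
    rw [← intervalIntegral.integral_Iic_sub_Iic integrable_stdphi.integrableOn
      integrable_stdphi.integrableOn]
    simp [stdPhi]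
  rw [h]
  exact (intervalIntegral.integral_hasDerivAt_right (continuous_stdphi.intervalIntegrable _ _)
    (continuous_stdphi.stronglyMeasurableAtFilter _ _) continuous_stdphi.continuousAt).const_add _

lemma continuous_stdPhi : Continuous stdPhi :=
  continuous_iff_continuousAt.2 fun x => (hasDerivAt_stdPhi x).continuousAt

lemma strictMono_stdPhi : StrictMono stdPhi :=
  strictMono_of_hasDerivAt_pos hasDerivAt_stdPhi stdphi_pos

lemma stdPhi_pos (x : ℝ) : 0 < stdPhi x := by
  have h : 0 ≤ stdPhi (x - 1) := by
    rw [stdPhi_eq_cdf]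
    exact cdf_nonneg _ _
  exact h.trans_lt (strictMono_stdPhi (by linarith))

lemma stdPhi_lt_one (x : ℝ) : stdPhi x < 1 := by
  have h : stdPhi (x + 1) ≤ 1 := by
    rw [stdPhi_eq_cdf]
    exact cdf_le_one _ _
  exact (strictMono_stdPhi (by linarith)).trans_le h

lemma exists_stdPhi_eq {p : ℝ} (h0 : 0 < p) (h1 : p < 1) : ∃ z, stdPhi z = p := by
  obtain ⟨l, hl⟩ := (tendsto_stdPhi_atBot.eventually_lt_const h0).exists
  obtain ⟨r, hr⟩ := (tendsto_stdPhi_atTop.eventually_const_lt h1).exists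
  exact mem_range_of_exists_le_of_exists_ge continuous_stdPhi ⟨l, hl.le⟩ ⟨r, hr.le⟩

lemma hasDerivAt_stdPhiInv {p : ℝ} (h0 : 0 < p) (h1 : p < 1) :
    HasDerivAt stdPhiInv (stdphi (stdPhiInv p))⁻¹ p := by
  have hinv : ∀ z, stdPhiInv (stdPhi z) = z :=
    Function.leftInverse_invFun strictMono_stdPhi.injective
  obtain ⟨z, rfl⟩ := exists_stdPhi_eq h0 h1
  rw [hinv]
  exact ((hasStrictDerivAt_of_hasDerivAt_of_continuousAt
    (Eventually.of_forall hasDerivAt_stdPhi) continuous_stdphi.continuousAt).to_local_left_inverse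
      (stdphi_pos z).ne' (Eventually.of_forall hinv)).hasDerivAt

lemma integral_Iic_normalPDF {s : ℝ} (hs : 0 < s) (m c : ℝ) :
    ∫ v in Iic c, normalPDF s m v = stdPhi ((c - m) / s) := by
  have h (v : ℝ) : HasDerivAt (fun v => stdPhi ((v - m) / s)) (normalPDF s m v) v := by
    have h1 : HasDerivAt (fun v : ℝ => (v - m) / s) (1 / s) v :=
      ((hasDerivAt_id v).sub_const m).div_const s
    exact ((hasDerivAt_stdPhi ((v - m) / s)).comp v h1).congr_deriv (mul_comm _ _)
  have hlim : Tendsto (fun v => stdPhi ((v - m) / s)) atBot (𝓝 0) :=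
    tendsto_stdPhi_atBot.comp
      ((tendsto_atBot_add_const_right _ (-m) tendsto_id).atBot_div_const hs)
  rw [integral_Iic_of_hasDerivAt_of_tendsto' (fun v _ => h v)
    (integrable_normalPDF hs m).integrableOn hlim, sub_zero]

lemma hasDerivAt_stdPhiE (c : EReal) (x s : ℝ) :
    HasDerivAt (fun y => stdPhiE c y s) (-((1 / s) * stdphiE c x s)) x := by
  unfold stdPhiE stdphiE
  split_ifs
  · simpa using hasDerivAt_const x (1 : ℝ)
  · simpa using hasDerivAt_const x (0 : ℝ)
  · have h1 : HasDerivAt (fun y : ℝ => (c.toReal - y) / s) (-1 / s) x :=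
      ((hasDerivAt_id x).const_sub c.toReal).div_const s
    refine ((hasDerivAt_stdPhi ((c.toReal - x) / s)).comp x h1).congr_deriv ?_
    ring

lemma continuous_stdPhiE (c : EReal) (s : ℝ) : Continuous fun x => stdPhiE c x s :=
  continuous_iff_continuousAt.2 fun x => (hasDerivAt_stdPhiE c x s).continuousAt

lemma norm_stdPhiE_le_one (c : EReal) (x s : ℝ) : ‖stdPhiE c x s‖ ≤ 1 := by
  unfold stdPhiE
  split_ifs
  · simp
  · simp
  · rw [Real.norm_of_nonneg (stdPhi_pos _).le]
    exact (stdPhi_lt_one _).le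

lemma stdPhiE_lt_stdPhiE {s : ℝ} (hs : 0 < s) (x : ℝ) {c d : EReal} (h : c < d) :
    stdPhiE c x s < stdPhiE d x s := by
  have hc : c ≠ ⊤ := h.ne_top
  have hd : d ≠ ⊥ := h.ne_bot
  unfold stdPhiE
  rw [if_neg hc, if_neg hd]
  split_ifs with h1 h2 h2
  · exact zero_lt_one
  · exact stdPhi_pos _
  · exact stdPhi_lt_one _
  · apply strictMono_stdPhi
    have : c.toReal < d.toReal := by
      rwa [← EReal.coe_lt_coe_iff, EReal.coe_toReal hc ‹_›, EReal.coe_toReal ‹_› hd]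
    gcongr

lemma truncSum_pos {k : ℕ} {a b : Fin (k + 1) → EReal} (hab : ∀ i, a i < b i) {s : ℝ}
    (hs : 0 < s) (x : ℝ) : 0 < truncSum a b s x :=
  Finset.sum_pos (fun i _ => sub_pos.2 (stdPhiE_lt_stdPhiE hs x (hab i)))
    Finset.univ_nonempty

lemma hasDerivAt_truncSum {k : ℕ} (a b : Fin k → EReal) (s x : ℝ) :
    HasDerivAt (fun y => truncSum a b s y)
      (∑ i, (-((1 / s) * stdphiE (b i) x s) - -((1 / s) * stdphiE (a i) x s))) x :=
  HasDerivAt.fun_sum fun i _ => (hasDerivAt_stdPhiE (b i) x s).sub (hasDerivAt_stdPhiE (a i) x s)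

lemma integrable_normalPDF_mul_stdPhiE {σ : ℝ} (hσ : 0 < σ) (τ m : ℝ) (c : EReal) :
    Integrable fun u => normalPDF σ m u * stdPhiE c u τ :=
  (integrable_normalPDF hσ m).mul_bdd (c := 1) (continuous_stdPhiE c τ).aestronglyMeasurable
    (ae_of_all _ fun u => norm_stdPhiE_le_one c u τ)

lemma integrable_normalPDF_mul_stdPhiE_sub {σ : ℝ} (hσ : 0 < σ) (τ m : ℝ) (c d : EReal) :
    Integrable fun u => normalPDF σ m u * stdPhiE d u τ - normalPDF σ m u * stdPhiE c u τ :=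
  (integrable_normalPDF_mul_stdPhiE hσ τ m d).sub (integrable_normalPDF_mul_stdPhiE hσ τ m c)

lemma toNNReal_sqrt_add_sq {σ τ : ℝ} (hσ : 0 < σ) (hτ : 0 < τ) :
    Real.toNNReal (Real.sqrt (σ ^ 2 + τ ^ 2)) ^ 2 = Real.toNNReal σ ^ 2 + Real.toNNReal τ ^ 2 := by
  rw [← NNReal.coe_inj]
  push_cast
  rw [Real.coe_toNNReal _ (Real.sqrt_nonneg _), Real.coe_toNNReal _ hσ.le,
    Real.coe_toNNReal _ hτ.le, Real.sq_sqrt (by positivity)]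

lemma integral_normalPDF {s : ℝ} (hs : 0 < s) (m : ℝ) : ∫ u, normalPDF s m u = 1 := by
  rw [normalPDF_eq_gaussianPDFReal hs]
  exact integral_gaussianPDFReal_eq_one _ (by simpa using hs)

lemma integral_normalPDF_mul_stdPhi {σ τ : ℝ} (hσ : 0 < σ) (hτ : 0 < τ) (m c : ℝ) :
    ∫ u, normalPDF σ m u * stdPhi ((c - u) / τ) = stdPhi ((c - m) / Real.sqrt (σ ^ 2 + τ ^ 2)) := by
  have hs : 0 < Real.sqrt (σ ^ 2 + τ ^ 2) := by positivity
  rw [← integral_Iic_normalPDF hs, ← gaussianReal_real_Iic hs, toNNReal_sqrt_add_sq hσ hτ]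
  conv_rhs => rw [← add_zero m]
  rw [← gaussianReal_conv_gaussianReal, ← integral_indicator_one measurableSet_Iic,
    MeasureTheory.integral_conv ((integrable_const _).indicator measurableSet_Iic),
    integral_gaussianReal_eq_integral_smul (by simpa using hσ), normalPDF_eq_gaussianPDFReal hσ]
  congr with u
  have h : (fun y : ℝ => (Iic c).indicator (1 : ℝ → ℝ) (u + y)) = (Iic (c - u)).indicator 1 := by
    ext y
    simp only [indicator, mem_Iic, le_sub_iff_add_le']
    rfl
  rw [h, integral_indicator_one measurableSet_Iic, gaussianReal_real_Iic hτ,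
    integral_Iic_normalPDF hτ, sub_zero, smul_eq_mul]

lemma integral_normalPDF_mul_stdPhiE {σ τ : ℝ} (hσ : 0 < σ) (hτ : 0 < τ) (m : ℝ) (c : EReal) :
    ∫ u, normalPDF σ m u * stdPhiE c u τ = stdPhiE c m (Real.sqrt (σ ^ 2 + τ ^ 2)) := by
  unfold stdPhiE
  split_ifs
  · simpa using integral_normalPDF hσ m
  · simp
  · exact integral_normalPDF_mul_stdPhi hσ hτ m _

/-- Completing the square in a product of two normal densities. -/
lemma normalPDF_mul_stdphi {σ τ : ℝ} (hσ : 0 < σ) (hτ : 0 < τ) (m c u : ℝ) :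
    normalPDF σ m u * ((1 / τ) * stdphi ((c - u) / τ)) =
      normalPDF (Real.sqrt (σ ^ 2 + τ ^ 2)) m c *
        normalPDF (σ * Real.sqrt (τ ^ 2 / (σ ^ 2 + τ ^ 2)))
          (τ ^ 2 / (σ ^ 2 + τ ^ 2) * m + (1 - τ ^ 2 / (σ ^ 2 + τ ^ 2)) * c) u := by
  have hs : 0 < Real.sqrt (σ ^ 2 + τ ^ 2) := by positivity
  have hs2 : Real.sqrt (σ ^ 2 + τ ^ 2) ^ 2 = σ ^ 2 + τ ^ 2 := Real.sq_sqrt (by positivity)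
  have hρ : Real.sqrt (τ ^ 2 / (σ ^ 2 + τ ^ 2)) = τ / Real.sqrt (σ ^ 2 + τ ^ 2) := by
    rw [Real.sqrt_div (by positivity), Real.sqrt_sq hτ.le]
  generalize Real.sqrt (σ ^ 2 + τ ^ 2) = s at *
  rw [hρ, ← hs2]
  have hexp : -(((u - m) / σ) ^ 2) / 2 + -(((c - u) / τ) ^ 2) / 2 =
      -(((c - m) / s) ^ 2) / 2 +
        -(((u - (τ ^ 2 / s ^ 2 * m + (1 - τ ^ 2 / s ^ 2) * c)) / (σ * (τ / s))) ^ 2) / 2 := by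
    have hσs : 1 - τ ^ 2 / s ^ 2 = σ ^ 2 / s ^ 2 := by
      field_simp
      linarith
    rw [hσs]
    field_simp
    obtain rfl | h := eq_or_ne s 0
    · exact absurd hs (lt_irrefl _)
    · have h4 : s ^ 4 = (σ ^ 2 + τ ^ 2) ^ 2 := by rw [← hs2]; ring
      ring_nf
      simp only [h4, hs2]
      ring
  have hmul := congrArg Real.exp hexp
  rw [Real.exp_add, Real.exp_add] at hmul
  unfold normalPDF stdphi
  field_simp at hmul ⊢
  linear_combination hmul

lemma hasDerivAt_normalPDF {s : ℝ} (m u : ℝ) :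
    HasDerivAt (normalPDF s m) (-((u - m) / s ^ 2 * normalPDF s m u)) u := by
  have h1 : HasDerivAt (fun v : ℝ => (v - m) / s) (1 / s) u :=
    ((hasDerivAt_id u).sub_const m).div_const s
  refine (((hasDerivAt_stdphi ((u - m) / s)).comp u h1).const_mul (1 / s)).congr_deriv ?_
  unfold normalPDF
  ring

lemma hasDerivAt_normalPDF_mean {s : ℝ} (m u : ℝ) :
    HasDerivAt (fun m => normalPDF s m u) ((u - m) / s ^ 2 * normalPDF s m u) m := by
  have h1 : HasDerivAt (fun m : ℝ => (u - m) / s) (-1 / s) m :=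
    ((hasDerivAt_id m).const_sub u).div_const s
  refine (((hasDerivAt_stdphi ((u - m) / s)).comp m h1).const_mul (1 / s)).congr_deriv ?_
  unfold normalPDF
  ring

lemma abs_mul_stdphi_le (y : ℝ) :
    |y| * stdphi y ≤ Real.exp (-(y ^ 2) / 4) := by
  have h1 : |y| ≤ Real.exp (y ^ 2 / 4) := by
    have := Real.add_one_le_exp (y ^ 2 / 4)
    nlinarith [sq_nonneg (|y| / 2 - 1), sq_abs y]
  have h2 : (1 : ℝ) ≤ Real.sqrt (2 * Real.pi) := by
    rw [Real.one_le_sqrt]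
    linarith [Real.pi_gt_three]
  calc |y| * stdphi y ≤ Real.exp (y ^ 2 / 4) * Real.exp (-(y ^ 2) / 2) := by
        unfold stdphi
        gcongr
        exact div_le_self (Real.exp_pos _).le h2
    _ = Real.exp (-(y ^ 2) / 4) := by
        rw [← Real.exp_add]
        congr 1
        ring

/-- A bound, uniform for means within distance `1`, for the derivative in the mean. -/
lemma norm_deriv_normalPDF_mean_le {s : ℝ} (hs : 0 < s) {μ m : ℝ} (hm : |m - μ| < 1) (u : ℝ) :
    ‖(u - m) / s ^ 2 * normalPDF s m u‖ ≤
      1 / s ^ 2 * Real.exp (1 / (4 * s ^ 2)) * Real.exp (-(1 / (8 * s ^ 2)) * (u - μ) ^ 2) := by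
  have h := abs_mul_stdphi_le ((u - m) / s)
  have hle : -(((u - m) / s) ^ 2) / 4 ≤ 1 / (4 * s ^ 2) + -(1 / (8 * s ^ 2)) * (u - μ) ^ 2 := by
    have hm2 : (m - μ) ^ 2 < 1 := by
      rw [← sq_abs]
      nlinarith [abs_nonneg (m - μ)]
    have : 0 ≤ (2 + 2 * (u - m) ^ 2 - (u - μ) ^ 2) / (8 * s ^ 2) := by
      apply div_nonneg _ (by positivity)
      nlinarith [sq_nonneg ((u - m) - (m - μ))]
    have heq : 1 / (4 * s ^ 2) + -(1 / (8 * s ^ 2)) * (u - μ) ^ 2 - -(((u - m) / s) ^ 2) / 4 =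
        (2 + 2 * (u - m) ^ 2 - (u - μ) ^ 2) / (8 * s ^ 2) := by
      field_simp
      ring
    linarith
  have hnorm : ‖(u - m) / s ^ 2 * normalPDF s m u‖ =
      1 / s ^ 2 * (|(u - m) / s| * stdphi ((u - m) / s)) := by
    rw [norm_mul, Real.norm_of_nonneg (normalPDF_pos hs m u).le, Real.norm_eq_abs, abs_div, abs_div,
      abs_of_pos hs, abs_of_pos (pow_pos hs 2), normalPDF]
    ring
  rw [hnorm, mul_assoc, ← Real.exp_add]
  gcongr
  exact h.trans (Real.exp_le_exp.2 hle)

lemma integrable_deriv_normalPDF_mean {s : ℝ} (hs : 0 < s) (m : ℝ) :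
    Integrable fun u => (u - m) / s ^ 2 * normalPDF s m u := by
  have hb : Integrable fun u : ℝ => 1 / s ^ 2 * Real.exp (1 / (4 * s ^ 2)) *
      Real.exp (-(1 / (8 * s ^ 2)) * (u - m) ^ 2) :=
    ((integrable_exp_neg_mul_sq (b := 1 / (8 * s ^ 2)) (by positivity)).comp_sub_right m).const_mul _
  have hc : Continuous fun u => (u - m) / s ^ 2 * normalPDF s m u :=
    Continuous.mul (by fun_prop) (continuous_normalPDF s m)
  exact hb.mono' hc.aestronglyMeasurable
    (ae_of_all _ fun u => norm_deriv_normalPDF_mean_le hs (by simp) u)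

lemma hasDerivAt_integral_normalPDF_mul {σ : ℝ} (hσ : 0 < σ) {S : ℝ → ℝ} (hS : Continuous S)
    (hS1 : ∀ u, ‖S u‖ ≤ 1) (x μ : ℝ) :
    HasDerivAt (fun m => ∫ u in Iic x, normalPDF σ m u * S u)
      (∫ u in Iic x, (u - μ) / σ ^ 2 * normalPDF σ μ u * S u) μ := by
  have hb : Integrable fun u : ℝ => 1 / σ ^ 2 * Real.exp (1 / (4 * σ ^ 2)) *
      Real.exp (-(1 / (8 * σ ^ 2)) * (u - μ) ^ 2) :=
    ((integrable_exp_neg_mul_sq (b := 1 / (8 * σ ^ 2)) (by positivity)).comp_sub_right μ).const_mul _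
  have hc : Continuous fun u => (u - μ) / σ ^ 2 * normalPDF σ μ u * S u :=
    Continuous.mul (Continuous.mul (by fun_prop) (continuous_normalPDF σ μ)) hS
  refine (hasDerivAt_integral_of_dominated_loc_of_deriv_le
    (F := fun m u => normalPDF σ m u * S u)
    (F' := fun m u => (u - m) / σ ^ 2 * normalPDF σ m u * S u)
    (Metric.ball_mem_nhds μ one_pos)
    (Eventually.of_forall fun m => ((continuous_normalPDF σ m).mul hS).aestronglyMeasurable)
    ?_ hc.aestronglyMeasurable (ae_of_all _ fun u m hm => ?_) hb.restrict
    (ae_of_all _ fun u m _ => (hasDerivAt_normalPDF_mean m u).mul_const _)).2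
  · exact ((integrable_normalPDF hσ μ).mul_bdd (c := 1) hS.aestronglyMeasurable
      (ae_of_all _ hS1)).restrict
  · rw [norm_mul]
    exact (mul_le_of_le_one_right (norm_nonneg _) (hS1 u)).trans
      (norm_deriv_normalPDF_mean_le hσ (by simpa [Real.dist_eq] using hm) u)

lemma tendsto_normalPDF_atBot {s : ℝ} (hs : 0 < s) (m : ℝ) :
    Tendsto (normalPDF s m) atBot (𝓝 0) :=
  tendsto_zero_of_hasDerivAt_of_integrableOn_Iic (a := 0) (fun u _ => hasDerivAt_normalPDF m u)
    (integrable_deriv_normalPDF_mean hs m).neg.integrableOn (integrable_normalPDF hs m).integrableOn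

lemma normalPDF_mul_stdphiE {σ τ : ℝ} (hσ : 0 < σ) (hτ : 0 < τ) (m u : ℝ) (c : EReal) :
    normalPDF σ m u * ((1 / τ) * stdphiE c u τ) =
      (1 / Real.sqrt (σ ^ 2 + τ ^ 2)) * stdphiE c m (Real.sqrt (σ ^ 2 + τ ^ 2)) *
        normalPDF (σ * Real.sqrt (τ ^ 2 / (σ ^ 2 + τ ^ 2)))
          (τ ^ 2 / (σ ^ 2 + τ ^ 2) * m + (1 - τ ^ 2 / (σ ^ 2 + τ ^ 2)) * c.toReal) u := by
  unfold stdphiE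
  split_ifs
  · simp
  · simp
  · exact normalPDF_mul_stdphi hσ hτ m _ u

lemma integral_Iic_normalPDF_mul_stdphiE {σ τ : ℝ} (hσ : 0 < σ) (hτ : 0 < τ) (m x : ℝ)
    (c : EReal) :
    ∫ u in Iic x, normalPDF σ m u * ((1 / τ) * stdphiE c u τ) =
      (1 / Real.sqrt (σ ^ 2 + τ ^ 2)) * stdphiE c m (Real.sqrt (σ ^ 2 + τ ^ 2)) *
        GfunE σ τ m x c := by
  simp_rw [normalPDF_mul_stdphiE hσ hτ]
  rw [integral_const_mul, integral_Iic_normalPDF (by positivity)]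
  unfold stdphiE GfunE
  split_ifs <;> simp [Gfun]

lemma hasDerivAt_integral_normalPDF_mul_stdPhiE {σ τ : ℝ} (hσ : 0 < σ) (hτ : 0 < τ) (c : EReal)
    (x μ : ℝ) :
    HasDerivAt (fun m => ∫ u in Iic x, normalPDF σ m u * stdPhiE c u τ)
      (-(normalPDF σ μ x * stdPhiE c x τ) -
        (1 / Real.sqrt (σ ^ 2 + τ ^ 2)) * stdphiE c μ (Real.sqrt (σ ^ 2 + τ ^ 2)) *
          GfunE σ τ μ x c) μ := by
  refine (hasDerivAt_integral_normalPDF_mul hσ (continuous_stdPhiE c τ)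
    (norm_stdPhiE_le_one c · τ) x μ).congr_deriv ?_
  have hi1 : Integrable fun u => (u - μ) / σ ^ 2 * normalPDF σ μ u * stdPhiE c u τ :=
    (integrable_deriv_normalPDF_mean hσ μ).mul_bdd (c := 1)
      (continuous_stdPhiE c τ).aestronglyMeasurable (ae_of_all _ (norm_stdPhiE_le_one c · τ))
  have hi2 : Integrable fun u => normalPDF σ μ u * ((1 / τ) * stdphiE c u τ) := by
    simp_rw [normalPDF_mul_stdphiE hσ hτ]
    exact (integrable_normalPDF (by positivity) _).const_mul _
  have hderiv (u : ℝ) : HasDerivAt (fun u => -(normalPDF σ μ u * stdPhiE c u τ))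
      ((u - μ) / σ ^ 2 * normalPDF σ μ u * stdPhiE c u τ +
        normalPDF σ μ u * ((1 / τ) * stdphiE c u τ)) u :=
    ((hasDerivAt_normalPDF μ u).mul (hasDerivAt_stdPhiE c u τ)).neg.congr_deriv (by ring)
  have hlim : Tendsto (fun u => -(normalPDF σ μ u * stdPhiE c u τ)) atBot (𝓝 0) := by
    rw [← neg_zero]
    refine (squeeze_zero_norm (fun u => ?_) (tendsto_normalPDF_atBot hσ μ)).neg
    rw [norm_mul, Real.norm_of_nonneg (normalPDF_pos hσ μ u).le]
    exact mul_le_of_le_one_right (normalPDF_pos hσ μ u).le (norm_stdPhiE_le_one c u τ)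
  have h := integral_Iic_of_hasDerivAt_of_tendsto' (a := x) (fun u _ => hderiv u)
    (hi1.add hi2).integrableOn hlim
  rw [integral_add hi1.integrableOn hi2.integrableOn,
    integral_Iic_normalPDF_mul_stdphiE hσ hτ] at h
  linarith

lemma normalPDF_mul_truncSum {k : ℕ} (a b : Fin k → EReal) (σ τ m u : ℝ) :
    normalPDF σ m u * truncSum a b τ u =
      ∑ i, (normalPDF σ m u * stdPhiE (b i) u τ - normalPDF σ m u * stdPhiE (a i) u τ) := by
  simp_rw [truncSum, Finset.mul_sum, mul_sub]

lemma integrable_normalPDF_mul_truncSum {k : ℕ} (a b : Fin k → EReal) {σ : ℝ} (hσ : 0 < σ)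
    (τ m : ℝ) : Integrable fun u => normalPDF σ m u * truncSum a b τ u := by
  simp_rw [normalPDF_mul_truncSum]
  exact integrable_finsetSum _ fun i _ =>
    integrable_normalPDF_mul_stdPhiE_sub hσ τ m (a i) (b i)

lemma integral_normalPDF_mul_truncSum {k : ℕ} (a b : Fin k → EReal) {σ τ : ℝ} (hσ : 0 < σ)
    (hτ : 0 < τ) (m : ℝ) :
    ∫ u, normalPDF σ m u * truncSum a b τ u = truncSum a b (Real.sqrt (σ ^ 2 + τ ^ 2)) m := by
  simp_rw [normalPDF_mul_truncSum]
  rw [integral_finsetSum _ fun i _ =>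
    integrable_normalPDF_mul_stdPhiE_sub hσ τ m (a i) (b i), truncSum]
  refine Finset.sum_congr rfl fun i _ => ?_
  rw [integral_sub (integrable_normalPDF_mul_stdPhiE hσ τ m (b i))
    (integrable_normalPDF_mul_stdPhiE hσ τ m (a i)), integral_normalPDF_mul_stdPhiE hσ hτ,
    integral_normalPDF_mul_stdPhiE hσ hτ]

lemma setIntegral_normalPDF_mul_truncSum {k : ℕ} (a b : Fin k → EReal) {σ : ℝ} (hσ : 0 < σ)
    (τ m : ℝ) (s : Set ℝ) :
    ∫ u in s, normalPDF σ m u * truncSum a b τ u =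
      ∑ i, ((∫ u in s, normalPDF σ m u * stdPhiE (b i) u τ) -
        ∫ u in s, normalPDF σ m u * stdPhiE (a i) u τ) := by
  simp_rw [normalPDF_mul_truncSum]
  rw [integral_finsetSum _ fun i _ =>
    (integrable_normalPDF_mul_stdPhiE_sub hσ τ m (a i) (b i)).restrict]
  exact Finset.sum_congr rfl fun i _ => integral_sub
    (integrable_normalPDF_mul_stdPhiE hσ τ m (b i)).restrict
    (integrable_normalPDF_mul_stdPhiE hσ τ m (a i)).restrict

lemma Fmu_eq_div {k : ℕ} (a b : Fin k → EReal) (σ τ m x : ℝ) :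
    Fmu a b σ τ m x = (∫ u in Iic x, normalPDF σ m u * truncSum a b τ u) /
      truncSum a b (Real.sqrt (σ ^ 2 + τ ^ 2)) m :=
  integral_div _ _

lemma hasDerivAt_setIntegral_normalPDF_mul_truncSum {k : ℕ} (a b : Fin k → EReal) {σ τ : ℝ}
    (hσ : 0 < σ) (hτ : 0 < τ) (x μ : ℝ) :
    HasDerivAt (fun m => ∫ u in Iic x, normalPDF σ m u * truncSum a b τ u)
      (-(normalPDF σ μ x * truncSum a b τ x) -
        ∑ i, ((1 / Real.sqrt (σ ^ 2 + τ ^ 2)) * stdphiE (b i) μ (Real.sqrt (σ ^ 2 + τ ^ 2)) *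
            GfunE σ τ μ x (b i) -
          (1 / Real.sqrt (σ ^ 2 + τ ^ 2)) * stdphiE (a i) μ (Real.sqrt (σ ^ 2 + τ ^ 2)) *
            GfunE σ τ μ x (a i))) μ := by
  simp_rw [setIntegral_normalPDF_mul_truncSum a b hσ τ]
  refine (HasDerivAt.fun_sum fun i _ =>
    (hasDerivAt_integral_normalPDF_mul_stdPhiE hσ hτ (b i) x μ).sub
      (hasDerivAt_integral_normalPDF_mul_stdPhiE hσ hτ (a i) x μ)).congr_deriv ?_
  rw [normalPDF_mul_truncSum, ← Finset.sum_neg_distrib, ← Finset.sum_sub_distrib]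
  exact Finset.sum_congr rfl fun i _ => by ring

lemma setIntegral_pos_of_pos {f : ℝ → ℝ} (hf : Integrable f) (hpos : ∀ u, 0 < f u) {s : Set ℝ}
    (hs : 0 < volume s) : 0 < ∫ u in s, f u := by
  rw [setIntegral_pos_iff_support_of_nonneg_ae (ae_of_all _ fun u => (hpos u).le) hf.integrableOn,
    Function.support_eq_univ fun u => (hpos u).ne', univ_inter]
  exact hs

lemma Fmu_mem_Ioo {k : ℕ} {a b : Fin (k + 1) → EReal} (hab : ∀ i, a i < b i) {σ τ : ℝ}
    (hσ : 0 < σ) (hτ : 0 < τ) (m x : ℝ) : Fmu a b σ τ m x ∈ Ioo 0 1 := by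
  have hD : 0 < truncSum a b (Real.sqrt (σ ^ 2 + τ ^ 2)) m := truncSum_pos hab (by positivity) m
  have hint := integrable_normalPDF_mul_truncSum a b hσ τ m
  have hpos (u : ℝ) : 0 < normalPDF σ m u * truncSum a b τ u :=
    mul_pos (normalPDF_pos hσ m u) (truncSum_pos hab hτ u)
  rw [Fmu_eq_div]
  constructor
  · exact div_pos (setIntegral_pos_of_pos hint hpos (by simp)) hD
  · rw [div_lt_one hD, ← integral_normalPDF_mul_truncSum a b hσ hτ,
      ← integral_add_compl measurableSet_Iic hint (s := Iic x), compl_Iic]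
    exact lt_add_of_pos_right _ (setIntegral_pos_of_pos hint hpos (by simp))

lemma hfunE_eq_div {k : ℕ} (a b : Fin k → EReal) (σ τ μ : ℝ) (c : EReal) :
    hfunE a b σ τ μ c =
      (1 / Real.sqrt (σ ^ 2 + τ ^ 2)) * stdphiE c μ (Real.sqrt (σ ^ 2 + τ ^ 2)) /
        truncSum a b (Real.sqrt (σ ^ 2 + τ ^ 2)) μ := by
  unfold hfunE stdphiE
  split_ifs <;> simp [hfun]

lemma hasDerivAt_Fmu {k : ℕ} {a b : Fin (k + 1) → EReal} (hab : ∀ i, a i < b i) {σ τ : ℝ}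
    (hσ : 0 < σ) (hτ : 0 < τ) (x μ : ℝ) :
    HasDerivAt (fun m => Fmu a b σ τ m x)
      (-condPDF a b σ τ μ x
        + ∑ i, (hfunE a b σ τ μ (b i) * (Fmu a b σ τ μ x - GfunE σ τ μ x (b i))
            - hfunE a b σ τ μ (a i) * (Fmu a b σ τ μ x - GfunE σ τ μ x (a i)))) μ := by
  have hD : 0 < truncSum a b (Real.sqrt (σ ^ 2 + τ ^ 2)) μ := truncSum_pos hab (by positivity) μ
  have hF : (fun m => Fmu a b σ τ m x) = fun m =>
      (∫ u in Iic x, normalPDF σ m u * truncSum a b τ u) /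
        truncSum a b (Real.sqrt (σ ^ 2 + τ ^ 2)) m := funext fun m => Fmu_eq_div a b σ τ m x
  rw [hF]
  refine ((hasDerivAt_setIntegral_normalPDF_mul_truncSum a b hσ hτ x μ).div
    (hasDerivAt_truncSum a b _ μ) hD.ne').congr_deriv ?_
  have hN : (∫ u in Iic x, normalPDF σ μ u * truncSum a b τ u) =
      Fmu a b σ τ μ x * truncSum a b (Real.sqrt (σ ^ 2 + τ ^ 2)) μ := by
    rw [Fmu_eq_div, div_mul_cancel₀ _ hD.ne']
  have hf : condPDF a b σ τ μ x = normalPDF σ μ x * truncSum a b τ x /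
      truncSum a b (Real.sqrt (σ ^ 2 + τ ^ 2)) μ := rfl
  simp_rw [hN, hf, hfunE_eq_div]
  generalize truncSum a b (Real.sqrt (σ ^ 2 + τ ^ 2)) μ = D at *
  generalize Fmu a b σ τ μ x = F
  have hsum : ∀ p q g g' : Fin (k + 1) → ℝ,
      ∑ i, (p i / D * (F - g i) - q i / D * (F - g' i)) =
        -(F * (∑ i, (-p i - -q i)) + ∑ i, (p i * g i - q i * g' i)) / D := by
    intro p q g g'
    rw [Finset.mul_sum, ← Finset.sum_add_distrib, ← Finset.sum_neg_distrib, Finset.sum_div]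
    exact Finset.sum_congr rfl fun i _ => by ring
  rw [hsum]
  field_simp
  ring

/-- Lemma 2 (`le_dmu_formula`): explicit formula for the derivative of `Φ⁻¹(F_μ(x))` in `μ`. -/
theorem stmt11 {k : ℕ} (a b : Fin (k + 1) → EReal) (hab : truncOrdered a b)
    (σ τ : ℝ) (hσ : 0 < σ) (hτ : 0 < τ) (x μ : ℝ) :
    HasDerivAt (fun m => stdPhiInv (Fmu a b σ τ m x))
      ((-condPDF a b σ τ μ x
          + ∑ i, (hfunE a b σ τ μ (b i) * (Fmu a b σ τ μ x - GfunE σ τ μ x (b i))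
              - hfunE a b σ τ μ (a i) * (Fmu a b σ τ μ x - GfunE σ τ μ x (a i))))
        / stdphi (stdPhiInv (Fmu a b σ τ μ x))) μ := by
  obtain ⟨h0, h1⟩ := Fmu_mem_Ioo hab.1 hσ hτ μ x
  refine ((hasDerivAt_stdPhiInv h0 h1).comp μ (hasDerivAt_Fmu hab.1 hσ hτ x μ)).congr_deriv ?_
  rw [div_eq_inv_mul]
end
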